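/- Let X be a set equipped with a symmetric adjacency relation ∼ making (X,∼) a connected graph, let Y ⊆ X be nonempty, and let F : Y → ℝ be bounded. Then there exists exactly one bounded function u : X → ℝ such that u = F on Y and u(x) = (sup{u(y) : y ∼ x} + inf{u(y) : y ∼ x})/2 for every x ∈ X ∖ Y. -/

import Mathlib

/-- Two-sided form of infinity-harmonicity, without suprema. -/
def HarmAux {X : Type*} (adj : X → X → Prop) (Y : Set X) (u : X → ℝ) : Prop :=
  ∀ x ∉ Y, ∀ y, adj x y → ∀ η > 0,
    (∃ z, adj x z ∧ u z + u y ≤ 2 * u x + η) ∧ (∃ z, adj x z ∧ 2 * u x - η ≤ u z + u y)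

lemma HarmAux.neg {X : Type*} {adj : X → X → Prop} {Y : Set X} {u : X → ℝ}
    (h : HarmAux adj Y u) : HarmAux adj Y (fun x => - u x) := by
  intro x hx y hy η hη
  obtain ⟨⟨z, hz, h1⟩, ⟨z', hz', h2⟩⟩ := h x hx y hy η hη
  exact ⟨⟨z', hz', by linarith⟩, ⟨z, hz, by linarith⟩⟩

lemma harmAux_of_eq {X : Type*} (adj : X → X → Prop) (Y : Set X) (u : X → ℝ) (M : ℝ)
    (hM : ∀ x, |u x| ≤ M)
    (h : ∀ x ∉ Y, u x = (sSup (u '' {y | adj x y}) + sInf (u '' {y | adj x y})) / 2) :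
    HarmAux adj Y u := by
  intro x hx y hy η hη
  have hne : (u '' {y | adj x y}).Nonempty := ⟨u y, y, hy, rfl⟩
  have hba : BddAbove (u '' {y | adj x y}) := by
    refine ⟨M, ?_⟩
    rintro _ ⟨z, -, rfl⟩
    exact (abs_le.1 (hM z)).2
  have hbb : BddBelow (u '' {y | adj x y}) := by
    refine ⟨-M, ?_⟩
    rintro _ ⟨z, -, rfl⟩
    exact (abs_le.1 (hM z)).1
  have hx' := h x hx
  have h1 : u y ≤ sSup (u '' {y | adj x y}) := le_csSup hba ⟨y, hy, rfl⟩
  have h2 : sInf (u '' {y | adj x y}) ≤ u y := csInf_le hbb ⟨y, hy, rfl⟩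
  constructor
  · obtain ⟨_, ⟨z, hz, rfl⟩, h3⟩ := exists_lt_of_csInf_lt hne (lt_add_of_pos_right _ hη)
    exact ⟨z, hz, by linarith⟩
  · obtain ⟨_, ⟨z, hz, rfl⟩, h3⟩ := exists_lt_of_lt_csSup hne (sub_lt_self _ hη)
    exact ⟨z, hz, by linarith⟩

/-- Comparison of a subsolution with slope bounded below against a supersolution. -/
lemma strict_compare {X : Type*} (adj : X → X → Prop) (Y : Set X)
    (w v : X → ℝ) (γ B L : ℝ) (hγ : 0 < γ)
    (hwB : ∀ x, w x ≤ B) (hvL : ∀ x, L ≤ v x)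
    (hv : HarmAux adj Y v) (hY : ∀ x ∈ Y, w x ≤ v x)
    (hw : ∀ x ∉ Y, ∃ s, γ ≤ s ∧ (∀ η > 0, ∃ y, adj x y ∧ w x + s - η ≤ w y) ∧
      ∀ y, adj x y → w x - s ≤ w y) (x0 : X) : w x0 ≤ v x0 := by
  have key : ∀ ε > 0, ∀ x, w x + ε * Real.exp (w x) - v x ≤ ε * Real.exp B := by
    intro ε hε
    set f : X → ℝ := fun x => w x + ε * Real.exp (w x) - v x with hf
    have hexpB : ∀ x, ε * Real.exp (w x) ≤ ε * Real.exp B := fun x =>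
      mul_le_mul_of_nonneg_left (Real.exp_le_exp.2 (hwB x)) hε.le
    have hbdd : BddAbove (Set.range f) := by
      refine ⟨B + ε * Real.exp B - L, ?_⟩
      rintro _ ⟨x, rfl⟩
      have := hexpB x
      have := hwB x
      have := hvL x
      simp only [hf]; linarith
    set S := sSup (Set.range f) with hS
    have hle : ∀ x, f x ≤ S := fun x => le_csSup hbdd ⟨x, rfl⟩
    suffices hSκ : S ≤ ε * Real.exp B from fun x => (hle x).trans hSκ
    by_contra hcon
    push Not at hcon
    set K := ε * Real.exp L with hK
    have hKpos : 0 < K := by positivity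
    set η := min (S - ε * Real.exp B) (K * γ ^ 2 / (2 * (4 + K * (2 + γ ^ 2)))) with hη
    have hηpos : 0 < η := lt_min (by linarith) (by positivity)
    have hη1 : η ≤ S - ε * Real.exp B := min_le_left _ _
    have hη2 : η * (2 * (4 + K * (2 + γ ^ 2))) ≤ K * γ ^ 2 := by
      rw [← le_div_iff₀ (by positivity)]
      exact min_le_right _ _
    obtain ⟨_, ⟨x, rfl⟩, hx⟩ := exists_lt_of_lt_csSup (Set.range_nonempty_iff_nonempty.2 ⟨x0⟩ : (Set.range f).Nonempty)
      (sub_lt_self S hηpos)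
    have hfx : w x + ε * Real.exp (w x) - v x > S - η := hx
    have hxY : x ∉ Y := by
      intro hxY
      have := hY x hxY
      have := hexpB x
      linarith
    obtain ⟨s, hs, hs1, hs2⟩ := hw x hxY
    obtain ⟨y, hy, hwy⟩ := hs1 η hηpos
    obtain ⟨⟨z, hz, hvz⟩, -⟩ := hv x hxY y hy η hηpos
    have hwz := hs2 z hz
    have hfy : w y + ε * Real.exp (w y) - v y ≤ S := hle y
    have hfz : w z + ε * Real.exp (w z) - v z ≤ S := hle z
    have hwxL : L ≤ w x := by
      have := hexpB x
      have := hvL x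
      linarith
    have hey : Real.exp (w x + s - η) ≤ Real.exp (w y) := Real.exp_le_exp.2 hwy
    have hez : Real.exp (w x - s) ≤ Real.exp (w z) := Real.exp_le_exp.2 hwz
    have hez' : Real.exp (w x - s - η) ≤ Real.exp (w x - s) := Real.exp_le_exp.2 (by linarith)
    have hcosh : 2 + γ ^ 2 ≤ Real.exp s + Real.exp (-s) := by
      have h1 : s / 2 ≤ Real.sinh (s / 2) := Real.self_le_sinh_iff.2 (by linarith)
      rw [Real.sinh_eq] at h1
      have e1 : Real.exp s = Real.exp (s / 2) * Real.exp (s / 2) := by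
        rw [← Real.exp_add]; ring_nf
      have e2 : Real.exp (-s) = Real.exp (-(s / 2)) * Real.exp (-(s / 2)) := by
        rw [← Real.exp_add]; ring_nf
      have e3 : Real.exp (s / 2) * Real.exp (-(s / 2)) = 1 := by
        rw [← Real.exp_add]; simp
      have h2 : γ ≤ Real.exp (s / 2) - Real.exp (-(s / 2)) := by linarith
      rw [e1, e2]
      nlinarith
    have hηexp : 1 - η ≤ Real.exp (-η) := by
      have := Real.add_one_le_exp (-η)
      linarith
    have hsum : Real.exp (w x) * ((1 - η) * (2 + γ ^ 2)) ≤ Real.exp (w y) + Real.exp (w z) := by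
      have e1 : Real.exp (w x + s - η) = Real.exp (w x) * (Real.exp (-η) * Real.exp s) := by
        rw [← Real.exp_add, ← Real.exp_add]; ring_nf
      have e2 : Real.exp (w x - s - η) = Real.exp (w x) * (Real.exp (-η) * Real.exp (-s)) := by
        rw [← Real.exp_add, ← Real.exp_add]; ring_nf
      have h3 : (1 - η) * (2 + γ ^ 2) ≤ Real.exp (-η) * (Real.exp s + Real.exp (-s)) :=
        (mul_le_mul_of_nonneg_right hηexp (by positivity)).trans
          (mul_le_mul_of_nonneg_left hcosh (Real.exp_pos _).le)
      have h4 := mul_le_mul_of_nonneg_left h3 (Real.exp_pos (w x)).le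
      nlinarith
    have hbr : 0 ≤ γ ^ 2 - η * (2 + γ ^ 2) := by
      by_contra hneg
      push Not at hneg
      have : K * (γ ^ 2 - η * (2 + γ ^ 2)) < 0 := mul_neg_of_pos_of_neg hKpos hneg
      nlinarith [mul_pos hKpos (pow_pos hγ 2)]
    have hKx : K ≤ ε * Real.exp (w x) :=
      mul_le_mul_of_nonneg_left (Real.exp_le_exp.2 hwxL) hε.le
    have h5 := mul_le_mul_of_nonneg_right hKx hbr
    have h6 := mul_le_mul_of_nonneg_left hsum hε.le
    nlinarith
  refine le_of_forall_pos_le_add fun c hc => ?_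
  have h := key (c / Real.exp B) (by positivity) x0
  have h1 : c / Real.exp B * Real.exp B = c := by field_simp
  have h2 : 0 < c / Real.exp B * Real.exp (w x0) := by positivity
  linarith

/-- Values achievable by walking, at cost `γ` per step, to the set `E`. -/
inductive WalkVal {X : Type*} (adj : X → X → Prop) (E : Set X) (u : X → ℝ) (γ : ℝ) : X → ℝ → Prop
  | base (x : X) (hx : x ∈ E) : WalkVal adj E u γ x (u x)
  | step (x y : X) (r : ℝ) (hx : x ∉ E) (hxy : adj x y) (h : WalkVal adj E u γ y r) :
      WalkVal adj E u γ x (r - γ)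

lemma compare_of_slope {X : Type*} (adj : X → X → Prop) (hadj : Symmetric adj)
    (hconn : ∀ x y : X, Relation.ReflTransGen adj x y)
    (Y : Set X) (hYne : Y.Nonempty) (u v : X → ℝ) (B L : ℝ)
    (huB : ∀ x, u x ≤ B) (hvL : ∀ x, L ≤ v x)
    (hu : HarmAux adj Y u) (hv : HarmAux adj Y v) (hY : ∀ x ∈ Y, u x ≤ v x)
    (x0 y0 : X) (hx0 : x0 ∉ Y) (hxy0 : adj x0 y0) (hne : u x0 ≠ u y0) : u x0 ≤ v x0 := by
  -- a neighbor with strictly larger value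
  obtain ⟨y1, hy1, hlt⟩ : ∃ y, adj x0 y ∧ u x0 < u y := by
    rcases lt_or_gt_of_ne hne with h | h
    · exact ⟨y0, hxy0, h⟩
    · obtain ⟨-, z, hz, h2⟩ := hu x0 hx0 y0 hxy0 ((u x0 - u y0) / 2) (by linarith)
      exact ⟨z, hz, by linarith⟩
  set γ := (u y1 - u x0) / 2 with hγdef
  have hγ : 0 < γ := by linarith
  set E : Set X := {x | x ∈ Y ∨ ∃ y, adj x y ∧ u x + γ < u y} with hE
  have hYE : ∀ x ∈ Y, x ∈ E := fun x hx => Or.inl hx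
  have hx0E : x0 ∈ E := Or.inr ⟨y1, hy1, by linarith⟩
  have hnE : ∀ x ∉ E, ∀ y, adj x y → u y ≤ u x + γ := by
    intro x hx y hxy
    by_contra h
    exact hx (Or.inr ⟨y, hxy, not_le.1 h⟩)
  have hnE' : ∀ x ∉ E, ∀ y, adj x y → u x - γ ≤ u y := by
    intro x hx y hxy
    refine le_of_forall_pos_le_add fun η hη => ?_
    obtain ⟨-, z, hz, h2⟩ := hu x (fun h => hx (Or.inl h)) y hxy η hη
    have := hnE x hx z hz
    linarith
  have hle : ∀ x r, WalkVal adj E u γ x r → r ≤ u x := by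
    intro x r h
    induction h with
    | base x hx => exact le_rfl
    | step x y r hx hxy h ih =>
      have := hnE x hx y hxy
      linarith
  have hbdd : ∀ x, BddAbove {r | WalkVal adj E u γ x r} := fun x => ⟨u x, fun r hr => hle x r hr⟩
  have hnonempty : ∀ x, {r | WalkVal adj E u γ x r}.Nonempty := by
    intro x
    obtain ⟨t, ht⟩ := hYne
    induction hconn x t using Relation.ReflTransGen.head_induction_on with
    | refl => exact ⟨_, WalkVal.base t (hYE t ht)⟩
    | head hab hbt ih =>
      rename_i a b
      by_cases ha : a ∈ E
      · exact ⟨_, WalkVal.base a ha⟩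
      · obtain ⟨r, hr⟩ := ih
        exact ⟨_, WalkVal.step a b r ha hab hr⟩
  set w : X → ℝ := fun x => sSup {r | WalkVal adj E u γ x r} with hw
  have hwu : ∀ x, w x ≤ u x := fun x => csSup_le (hnonempty x) fun r hr => hle x r hr
  have hwE : ∀ x ∈ E, w x = u x := fun x hx =>
    le_antisymm (hwu x) (le_csSup (hbdd x) (WalkVal.base x hx))
  have hwstep : ∀ x ∉ E, ∀ y, adj x y → w y - γ ≤ w x := by
    intro x hx y hxy
    have : w y ≤ w x + γ := csSup_le (hnonempty y) fun r hr => by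
      have : r - γ ≤ w x := le_csSup (hbdd x) (WalkVal.step x y r hx hxy hr)
      linarith
    linarith
  rw [← hwE x0 hx0E]
  refine strict_compare adj Y w v γ B L hγ (fun x => (hwu x).trans (huB x)) hvL hv
    (fun x hx => (hwu x).trans (hY x hx)) ?_ x0
  intro x hxY
  by_cases hxE : x ∈ E
  · obtain ⟨y2, hy2, hlt2⟩ : ∃ y, adj x y ∧ u x + γ < u y := hxE.resolve_left hxY
    have hne' : (u '' {y | adj x y}).Nonempty := ⟨_, y2, hy2, rfl⟩
    have hba : BddAbove (u '' {y | adj x y}) := by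
      refine ⟨B, ?_⟩
      rintro _ ⟨z, -, rfl⟩
      exact huB z
    set T := sSup (u '' {y | adj x y}) with hT
    have hTle : ∀ y, adj x y → u y ≤ T := fun y hy => le_csSup hba ⟨y, hy, rfl⟩
    have hT2 := hTle y2 hy2
    refine ⟨T - u x, by linarith, ?_, ?_⟩
    · intro η hη
      have : max (T - η) (u x + γ) < T := max_lt (by linarith) (by linarith)
      obtain ⟨_, ⟨y, hy, rfl⟩, h3⟩ := exists_lt_of_lt_csSup hne' this
      have h3a := (le_max_left _ _).trans_lt h3
      have h3b := (le_max_right _ _).trans_lt h3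
      have hyE : y ∈ E := by
        by_cases hyY : y ∈ Y
        · exact Or.inl hyY
        · obtain ⟨-, z, hz, h4⟩ := hu y hyY x (hadj hy) ((u y - (u x + γ)) / 2) (by linarith)
          exact Or.inr ⟨z, hz, by linarith⟩
      refine ⟨y, hy, ?_⟩
      rw [hwE x hxE, hwE y hyE]
      linarith
    · intro y hy
      rw [hwE x hxE]
      by_cases hyE : y ∈ E
      · rw [hwE y hyE]
        refine le_of_forall_pos_le_add fun η hη => ?_
        obtain ⟨-, z, hz, h2⟩ := hu x hxY y hy η hη
        have := hTle z hz
        linarith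
      · have := hwstep y hyE x (hadj hy)
        rw [hwE x hxE] at this
        linarith
  · refine ⟨γ, le_rfl, ?_, ?_⟩
    · intro η hη
      obtain ⟨r, hr, hlt⟩ := exists_lt_of_lt_csSup (hnonempty x) (sub_lt_self (w x) hη)
      cases hr with
      | base _ hx => exact absurd hx hxE
      | step _ y r hx hxy h =>
        have : r ≤ w y := le_csSup (hbdd y) h
        exact ⟨y, hxy, by linarith⟩
    · intro y hy
      by_cases hyE : y ∈ E
      · rw [hwE y hyE]
        have := hnE' x hxE y hy
        have := hwu x
        linarith
      · have := hwstep y hyE x (hadj hy)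
        linarith

lemma compare_main {X : Type*} (adj : X → X → Prop) (hadj : Symmetric adj)
    (hconn : ∀ x y : X, Relation.ReflTransGen adj x y)
    (Y : Set X) (hYne : Y.Nonempty) (u v : X → ℝ) (B C : ℝ)
    (huB : ∀ x, |u x| ≤ B) (hvC : ∀ x, |v x| ≤ C)
    (hu : HarmAux adj Y u) (hv : HarmAux adj Y v) (hY : ∀ x ∈ Y, u x = v x) (x : X) :
    u x ≤ v x := by
  obtain ⟨t, ht⟩ := id hYne
  induction hconn x t using Relation.ReflTransGen.head_induction_on with
  | refl => exact (hY t ht).le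
  | head hab hbt ih =>
    rename_i a b
    by_cases ha : a ∈ Y
    · exact (hY a ha).le
    by_cases h1 : u a = u b
    · by_cases h2 : v a = v b
      · rw [h1, h2]; exact ih
      · have := compare_of_slope adj hadj hconn Y hYne (fun x => - v x) (fun x => - u x) C (-B)
          (fun x => neg_le.1 (abs_le.1 (hvC x)).1) (fun x => neg_le_neg (abs_le.1 (huB x)).2)
          hv.neg hu.neg (fun x hx => by simp [hY x hx]) a b ha hab (by simpa using h2)
        simpa using this
    · exact compare_of_slope adj hadj hconn Y hYne u v B (-C) (fun x => (abs_le.1 (huB x)).2)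
        (fun x => (abs_le.1 (hvC x)).1) hu hv (fun x hx => (hY x hx).le) a b ha hab h1

lemma exists_harm {X : Type*} (adj : X → X → Prop)
    (hconn : ∀ x y : X, Relation.ReflTransGen adj x y)
    (Y : Set X) (hYne : Y.Nonempty) (F : X → ℝ) (M : ℝ) (hF : ∀ y ∈ Y, |F y| ≤ M) :
    ∃ u : X → ℝ, (∀ x, |u x| ≤ M) ∧ Set.EqOn u F Y ∧
      ∀ x ∉ Y, u x = (sSup (u '' {y | adj x y}) + sInf (u '' {y | adj x y})) / 2 := by
  classical
  have hnb : ∀ x ∉ Y, ∃ y, adj x y := by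
    intro x hx
    obtain ⟨t, ht⟩ := hYne
    rcases Relation.ReflTransGen.cases_head (hconn x t) with h | ⟨c, hc, -⟩
    · exact absurd (h ▸ ht) hx
    · exact ⟨c, hc⟩
  have hM0 : 0 ≤ M := by
    obtain ⟨t, ht⟩ := hYne
    exact (abs_nonneg _).trans (hF t ht)
  set T : (X → ℝ) → X → ℝ := fun g x =>
    if x ∈ Y then F x else (sSup (g '' {y | adj x y}) + sInf (g '' {y | adj x y})) / 2 with hT
  have hba : ∀ g : X → ℝ, (∀ x, |g x| ≤ M) → ∀ s : Set X, BddAbove (g '' s) := by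
    intro g hg s
    refine ⟨M, ?_⟩
    rintro _ ⟨z, -, rfl⟩
    exact (abs_le.1 (hg z)).2
  have hbb : ∀ g : X → ℝ, (∀ x, |g x| ≤ M) → ∀ s : Set X, BddBelow (g '' s) := by
    intro g hg s
    refine ⟨-M, ?_⟩
    rintro _ ⟨z, -, rfl⟩
    exact (abs_le.1 (hg z)).1
  have hTb : ∀ g : X → ℝ, (∀ x, |g x| ≤ M) → ∀ x, |T g x| ≤ M := by
    intro g hg x
    by_cases hx : x ∈ Y
    · simp only [hT, hx, if_true]; exact hF x hx
    · simp only [hT, hx, if_false]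
      obtain ⟨y, hy⟩ := hnb x hx
      have hne : (g '' {y | adj x y}).Nonempty := ⟨_, y, hy, rfl⟩
      have h1 : sSup (g '' {y | adj x y}) ≤ M := csSup_le hne (by
        rintro _ ⟨z, -, rfl⟩
        exact (abs_le.1 (hg z)).2)
      have h2 : -M ≤ sInf (g '' {y | adj x y}) := le_csInf hne (by
        rintro _ ⟨z, -, rfl⟩
        exact (abs_le.1 (hg z)).1)
      have h3 := csInf_le_csSup hne (hbb g hg _) (hba g hg _)
      rw [abs_le]; constructor <;> linarith
  have hTm : ∀ g h : X → ℝ, (∀ x, |g x| ≤ M) → (∀ x, |h x| ≤ M) → (∀ x, g x ≤ h x) →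
      ∀ x, T g x ≤ T h x := by
    intro g h hg hh hgh x
    by_cases hx : x ∈ Y
    · simp only [hT, hx, if_true]; exact le_rfl
    · simp only [hT, hx, if_false]
      obtain ⟨y, hy⟩ := hnb x hx
      have h1 : sSup (g '' {y | adj x y}) ≤ sSup (h '' {y | adj x y}) :=
        csSup_le ⟨_, y, hy, rfl⟩ (by
          rintro _ ⟨z, hz, rfl⟩
          exact (hgh z).trans (le_csSup (hba h hh _) ⟨z, hz, rfl⟩))
      have h2 : sInf (g '' {y | adj x y}) ≤ sInf (h '' {y | adj x y}) :=
        le_csInf ⟨_, y, hy, rfl⟩ (by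
          rintro _ ⟨z, hz, rfl⟩
          exact (csInf_le (hbb g hg _) ⟨z, hz, rfl⟩).trans (hgh z))
      linarith
  set A : Set (X → ℝ) := {g | (∀ x, |g x| ≤ M) ∧ ∀ x, g x ≤ T g x} with hA
  have hA0 : (fun _ => -M) ∈ A := by
    have h0 : ∀ x : X, |(fun _ : X => -M) x| ≤ M := fun x => by simp [abs_of_nonneg hM0]
    exact ⟨h0, fun x => (abs_le.1 (hTb _ h0 x)).1⟩
  set u : X → ℝ := fun x => sSup ((fun g : X → ℝ => g x) '' A) with hu
  have hAb : ∀ x, BddAbove ((fun g : X → ℝ => g x) '' A) := by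
    intro x
    refine ⟨M, ?_⟩
    rintro _ ⟨g, hg, rfl⟩
    exact (abs_le.1 (hg.1 x)).2
  have hgu : ∀ g ∈ A, ∀ x, g x ≤ u x := fun g hg x => le_csSup (hAb x) ⟨g, hg, rfl⟩
  have hub : ∀ x, |u x| ≤ M := by
    intro x
    rw [abs_le]
    refine ⟨hgu _ hA0 x, csSup_le ⟨_, _, hA0, rfl⟩ ?_⟩
    rintro _ ⟨g, hg, rfl⟩
    exact (abs_le.1 (hg.1 x)).2
  have huT : ∀ x, u x ≤ T u x := by
    intro x
    refine csSup_le ⟨_, _, hA0, rfl⟩ ?_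
    rintro _ ⟨g, hg, rfl⟩
    exact (hg.2 x).trans (hTm g u hg.1 hub (hgu g hg) x)
  have hTA : T u ∈ A := ⟨hTb u hub, hTm u (T u) hub (hTb u hub) huT⟩
  have hfix : ∀ x, u x = T u x := fun x => le_antisymm (huT x) (hgu _ hTA x)
  refine ⟨u, hub, ?_, ?_⟩
  · intro x hx
    rw [hfix x]; simp only [hT, hx, if_true]
  · intro x hx
    have h := hfix x
    simp only [hT, hx, if_false] at h
    exact h

/-- On a connected graph (symmetric adjacency relation) with a nonempty set `Y` of
terminal states and bounded `F` on `Y`, there is exactly one bounded function `u`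
with `u = F` on `Y` that is discrete infinity-harmonic at every `x ∉ Y`, i.e.
`u x = (sup {u y : y ∼ x} + inf {u y : y ∼ x}) / 2`. -/
theorem stmt17 {X : Type*} (adj : X → X → Prop) (hadj : Symmetric adj)
    (hconn : ∀ x y : X, Relation.ReflTransGen adj x y)
    (Y : Set X) (hY : Y.Nonempty) (F : X → ℝ)
    (hF : ∃ M : ℝ, ∀ y ∈ Y, |F y| ≤ M) :
    ∃! u : X → ℝ,
      (∃ M : ℝ, ∀ x : X, |u x| ≤ M) ∧ Set.EqOn u F Y ∧
        ∀ x ∉ Y,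
          u x = (sSup (u '' {y | adj x y}) + sInf (u '' {y | adj x y})) / 2 := by

  obtain ⟨M, hM⟩ := hF
  obtain ⟨u, hub, huY, hu⟩ := exists_harm adj hconn Y hY F M hM
  refine ⟨u, ⟨⟨M, hub⟩, huY, hu⟩, ?_⟩
  rintro v ⟨⟨C, hvb⟩, hvY, hv⟩
  have hu' := harmAux_of_eq adj Y u M hub hu
  have hv' := harmAux_of_eq adj Y v C hvb hv
  funext x
  exact le_antisymm
    (compare_main adj hadj hconn Y hY v u C M hvb hub hv' hu'
      (fun y hy => (hvY hy).trans (huY hy).symm) x)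
    (compare_main adj hadj hconn Y hY u v M C hub hvb hu' hv'
      (fun y hy => (huY hy).trans (hvY hy).symm) x)
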